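/- Let n be odd and let X = (X_{ij}) be the n×n matrix of indeterminates. Then the coefficient of the monomial ∏_{i=1}^n ∏_{j=1}^n X_{ij} in the polynomial per(X)·det(X)^{n−1} (a polynomial over ℤ in n² variables) equals (−1)^{n(n−1)/2}·n!·(n−1)!·AT(n). -/

import Mathlib

/-- `L` is a Latin square of order `n`: every row and every column is a
bijection of `Fin n` (i.e. contains each symbol exactly once). -/
def IsLatin {n : ℕ} (L : Fin n → Fin n → Fin n) : Prop :=
  (∀ i, Function.Bijective fun j => L i j) ∧ ∀ j, Function.Bijective fun i => L i j

/-- The permutation determined by a bijective function (junk value `1` otherwise). -/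
noncomputable def permOf {n : ℕ} (f : Fin n → Fin n) : Equiv.Perm (Fin n) :=
  if h : Function.Bijective f then Equiv.ofBijective f h else 1

/-- The product of the signs of the rows of `L`. -/
noncomputable def rowSign {n : ℕ} (L : Fin n → Fin n → Fin n) : ℤ :=
  ∏ i, (Equiv.Perm.sign (permOf fun j => L i j) : ℤ)

/-- The product of the signs of the columns of `L`. -/
noncomputable def colSign {n : ℕ} (L : Fin n → Fin n → Fin n) : ℤ :=
  ∏ j, (Equiv.Perm.sign (permOf fun i => L i j) : ℤ)

/-- The sign of a Latin square: row-sign times column-sign. -/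
noncomputable def latinSign {n : ℕ} (L : Fin n → Fin n → Fin n) : ℤ :=
  rowSign L * colSign L

/-- The permutation `α_s` of a Latin square `L`: `α_s i = j` iff `L i j = s`. -/
noncomputable def symPerm {n : ℕ} (L : Fin n → Fin n → Fin n) (s : Fin n) :
    Equiv.Perm (Fin n) :=
  permOf fun i => (permOf fun j => L i j).symm s

/-- The symbol-sign of a Latin square: the product of the signs of the `α_s`. -/
noncomputable def symbolSign {n : ℕ} (L : Fin n → Fin n → Fin n) : ℤ :=
  ∏ s, (Equiv.Perm.sign (symPerm L s) : ℤ)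

/-- The number of Latin squares of order `n`. -/
noncomputable def numLatin (n : ℕ) : ℕ :=
  Nat.card {L : Fin n → Fin n → Fin n // IsLatin L}

/-- The number of even Latin squares of order `n`. -/
noncomputable def numLatinEven (n : ℕ) : ℕ :=
  Nat.card {L : Fin n → Fin n → Fin n // IsLatin L ∧ latinSign L = 1}

/-- The number of odd Latin squares of order `n`. -/
noncomputable def numLatinOdd (n : ℕ) : ℕ :=
  Nat.card {L : Fin n → Fin n → Fin n // IsLatin L ∧ latinSign L = -1}

/-- `L` is normalized: its first row is the identity permutation. -/
def IsNormalized {n : ℕ} (L : Fin n → Fin n → Fin n) : Prop :=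
  ∀ j : Fin n, L ⟨0, j.pos⟩ j = j

/-- `L` is unipotent: all entries on the main diagonal are equal. -/
def IsUnipotent {n : ℕ} (L : Fin n → Fin n → Fin n) : Prop :=
  ∀ i k : Fin n, L i i = L k k

/-- The Alon-Tarsi constant `AT(n) = U_n^E - U_n^O`. -/
noncomputable def AT (n : ℕ) : ℤ :=
  (Nat.card {L : Fin n → Fin n → Fin n //
      IsLatin L ∧ IsNormalized L ∧ IsUnipotent L ∧ latinSign L = 1} : ℤ) -
  (Nat.card {L : Fin n → Fin n → Fin n //
      IsLatin L ∧ IsNormalized L ∧ IsUnipotent L ∧ latinSign L = -1} : ℤ)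

/-- `L` is reduced: first row and first column are the identity. -/
def IsReducedLatin {n : ℕ} (L : Fin n → Fin n → Fin n) : Prop :=
  IsNormalized L ∧ ∀ i : Fin n, L i ⟨0, i.pos⟩ = i

/-- The number of even reduced Latin squares of order `n`. -/
noncomputable def numReducedEven (n : ℕ) : ℕ :=
  Nat.card {L : Fin n → Fin n → Fin n // IsLatin L ∧ IsReducedLatin L ∧ latinSign L = 1}

/-- The number of odd reduced Latin squares of order `n`. -/
noncomputable def numReducedOdd (n : ℕ) : ℕ :=
  Nat.card {L : Fin n → Fin n → Fin n // IsLatin L ∧ IsReducedLatin L ∧ latinSign L = -1}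

/-- `L_n^SE(π)`: Latin squares whose permutation `α₁` (of the first symbol)
is `π` and whose symbol-sign is `+1`. The first symbol is the element of
`Fin n` with value `0`, and `α₁ = π` is expressed by `L i (π i) = first symbol`. -/
noncomputable def numSymEven (n : ℕ) (π : Equiv.Perm (Fin n)) : ℕ :=
  Nat.card {L : Fin n → Fin n → Fin n //
    IsLatin L ∧ (∀ i, (L i (π i)).val = 0) ∧ symbolSign L = 1}

/-- `L_n^SO(π)`: as `numSymEven` but with symbol-sign `-1`. -/
noncomputable def numSymOdd (n : ℕ) (π : Equiv.Perm (Fin n)) : ℕ :=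
  Nat.card {L : Fin n → Fin n → Fin n //
    IsLatin L ∧ (∀ i, (L i (π i)).val = 0) ∧ symbolSign L = -1}

/-- `L_n^CE(π)`: column-even Latin squares with first column `π`. -/
noncomputable def numColEven (n : ℕ) (π : Equiv.Perm (Fin n)) : ℕ :=
  Nat.card {L : Fin n → Fin n → Fin n //
    IsLatin L ∧ (∀ i : Fin n, L i ⟨0, i.pos⟩ = π i) ∧ colSign L = 1}

/-- `L_n^CO(π)`: column-odd Latin squares with first column `π`. -/
noncomputable def numColOdd (n : ℕ) (π : Equiv.Perm (Fin n)) : ℕ :=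
  Nat.card {L : Fin n → Fin n → Fin n //
    IsLatin L ∧ (∀ i : Fin n, L i ⟨0, i.pos⟩ = π i) ∧ colSign L = -1}

/-- `L_n^CE(α, β)`: column-even Latin squares with first row `α` and first column `β`. -/
noncomputable def numColEven₂ (n : ℕ) (α β : Equiv.Perm (Fin n)) : ℕ :=
  Nat.card {L : Fin n → Fin n → Fin n //
    IsLatin L ∧ (∀ j : Fin n, L ⟨0, j.pos⟩ j = α j) ∧
      (∀ i : Fin n, L i ⟨0, i.pos⟩ = β i) ∧ colSign L = 1}

/-- `L_n^CO(α, β)`: column-odd Latin squares with first row `α` and first column `β`. -/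
noncomputable def numColOdd₂ (n : ℕ) (α β : Equiv.Perm (Fin n)) : ℕ :=
  Nat.card {L : Fin n → Fin n → Fin n //
    IsLatin L ∧ (∀ j : Fin n, L ⟨0, j.pos⟩ j = α j) ∧
      (∀ i : Fin n, L i ⟨0, i.pos⟩ = β i) ∧ colSign L = -1}

/-- The `n × n` matrix of indeterminates, over `ℤ`. -/
noncomputable def Xmat (n : ℕ) :
    Matrix (Fin n) (Fin n) (MvPolynomial (Fin n × Fin n) ℤ) :=
  Matrix.of fun i j => MvPolynomial.X (i, j)

/-- The exponent vector of the square-free monomial `∏_{i,j} X i j`. -/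
noncomputable def allOnes (n : ℕ) : (Fin n × Fin n) →₀ ℕ :=
  Finsupp.equivFunOnFinite.symm fun _ => 1

/-- The `(0,1)`-matrix (over `ℤ`) associated to a Boolean matrix. -/
def toInt {n : ℕ} (A : Fin n → Fin n → Bool) : Matrix (Fin n) (Fin n) ℤ :=
  Matrix.of fun i j => if A i j then 1 else 0

/-- `σ₀(A)`: the number of zero entries of a `(0,1)`-matrix. -/
def sigma0 {n : ℕ} (A : Fin n → Fin n → Bool) : ℕ :=
  (Finset.univ.filter fun p : Fin n × Fin n => A p.1 p.2 = false).card

section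

open Finset Equiv

theorem permOf_apply {n : ℕ} {f : Fin n → Fin n} (h : Function.Bijective f) (i : Fin n) :
    permOf f i = f i := by
  rw [permOf, dif_pos h, ofBijective_apply]

theorem permOf_coe {n : ℕ} (σ : Perm (Fin n)) : permOf (fun i => σ i) = σ :=
  Equiv.ext fun i => permOf_apply σ.bijective i

theorem permOf_comp {n : ℕ} {f : Fin n → Fin n} (h : Function.Bijective f)
    (σ τ : Perm (Fin n)) : permOf (fun i => τ (f (σ i))) = τ * permOf f * σ :=
  Equiv.ext fun i => by
    rw [permOf_apply (f := fun i => τ (f (σ i))) ((τ.bijective.comp h).comp σ.bijective)]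
    simp [permOf_apply h]

namespace IsLatin

variable {n : ℕ} {L : Fin n → Fin n → Fin n}

theorem permOf_row_symm_bijective (hL : IsLatin L) (s : Fin n) :
    Function.Bijective fun i => (permOf fun j => L i j).symm s := by
  refine Finite.injective_iff_bijective.mp fun i k hik => ?_
  have h (i : Fin n) : L i ((permOf fun j => L i j).symm s) = s := by
    rw [← permOf_apply (hL.1 i), Equiv.apply_symm_apply]
  refine (hL.2 ((permOf fun j => L i j).symm s)).1 ?_
  simp only at hik ⊢
  rw [h i, hik, h k]

theorem symPerm_apply (hL : IsLatin L) (s i : Fin n) :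
    symPerm L s i = (permOf fun j => L i j).symm s :=
  permOf_apply (hL.permOf_row_symm_bijective s) i

theorem symPerm_apply_eq_iff (hL : IsLatin L) {s i j : Fin n} :
    symPerm L s i = j ↔ L i j = s := by
  rw [hL.symPerm_apply, Equiv.symm_apply_eq,
    permOf_apply (hL.1 i), eq_comm]

theorem apply_symPerm (hL : IsLatin L) (s i : Fin n) : L i (symPerm L s i) = s :=
  hL.symPerm_apply_eq_iff.mp rfl

theorem symPerm_apply_self (hL : IsLatin L) (i j : Fin n) : symPerm L (L i j) i = j :=
  hL.symPerm_apply_eq_iff.mpr rfl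

end IsLatin

theorem card_support_prodComm (n : ℕ) :
    #(Perm.support (prodComm (Fin n) (Fin n))) = n * (n - 1) := by
  have h : Perm.support (prodComm (Fin n) (Fin n)) = (univ : Finset (Fin n)).offDiag := by
    ext ⟨i, j⟩
    simp [eq_comm, Prod.ext_iff]
  rw [h, offDiag_card, card_univ, Fintype.card_fin, Nat.mul_sub_one]

theorem sign_prodComm (n : ℕ) :
    Perm.sign (prodComm (Fin n) (Fin n) : Perm (Fin n × Fin n)) = (-1) ^ (n * (n - 1) / 2) := by
  have h : (prodComm (Fin n) (Fin n) : Perm (Fin n × Fin n)) ^ 2 = 1 := by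
    ext x <;> simp [pow_two]
  rw [Perm.sign_of_pow_two_eq_one h, Perm.card_fixedPoints, Perm.sum_cycleType,
    Nat.sub_sub_self (card_le_univ _), card_support_prodComm]

theorem prod_sign_sq {ι : Type*} [Fintype ι] {n : ℕ} (σ : ι → Perm (Fin n)) :
    (∏ i, (Perm.sign (σ i) : ℤ)) * ∏ i, (Perm.sign (σ i) : ℤ) = 1 := by
  rw [← prod_mul_distrib]
  exact prod_eq_one fun i _ => by rw [← Units.val_mul, Int.units_mul_self, Units.val_one]

/-- The row-, column- and symbol-signs multiply to the sign of the transposition of the grid: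
`(i, j) ↦ (i, L i j) ↦ (j, L i j) ↦ (L i j, j)`. -/
theorem IsLatin.latinSign_mul_symbolSign {n : ℕ} {L : Fin n → Fin n → Fin n} (hL : IsLatin L) :
    latinSign L * symbolSign L = (-1) ^ (n * (n - 1) / 2) := by
  have key : prodCongrLeft (fun j => permOf fun i => L i j) =
      (prodComm (Fin n) (Fin n) : Perm (Fin n × Fin n)) * prodCongrLeft (symPerm L) *
      prodCongrRight (fun i => permOf fun j => L i j) := by
    ext ⟨i, j⟩ <;> simp [permOf_apply (hL.1 i), permOf_apply (hL.2 j), hL.symPerm_apply_self]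
  have hs := congrArg (fun σ => ((Perm.sign σ : ℤˣ) : ℤ)) key
  simp only [map_mul, Perm.sign_prodCongrLeft, Perm.sign_prodCongrRight, sign_prodComm,
    Units.val_mul, Units.coe_prod, Units.val_pow_eq_pow_val, Units.val_neg, Units.val_one] at hs
  have hr : rowSign L * rowSign L = 1 := prod_sign_sq _
  have hy : symbolSign L * symbolSign L = 1 := prod_sign_sq _
  change colSign L = _ * symbolSign L * rowSign L at hs
  rw [latinSign, hs]
  linear_combination (-1) ^ (n * (n - 1) / 2) * (symbolSign L * symbolSign L * hr + hy)

theorem IsLatin.symbolSign_eq {n : ℕ} {L : Fin n → Fin n → Fin n} (hL : IsLatin L) :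
    symbolSign L = (-1) ^ (n * (n - 1) / 2) * latinSign L := by
  have hr : rowSign L * rowSign L = 1 := prod_sign_sq _
  have hc : colSign L * colSign L = 1 := prod_sign_sq _
  have h := hL.latinSign_mul_symbolSign
  rw [latinSign] at *
  linear_combination (rowSign L * colSign L) * h - symbolSign L * (colSign L * colSign L * hr + hc)

theorem latinSign_eq_one_or {n : ℕ} (L : Fin n → Fin n → Fin n) :
    latinSign L = 1 ∨ latinSign L = -1 := by
  have hr : rowSign L * rowSign L = 1 := prod_sign_sq _
  have hc : colSign L * colSign L = 1 := prod_sign_sq _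
  rw [← sq_eq_one_iff, latinSign]
  linear_combination colSign L * colSign L * hr + hc

open Classical in
theorem AT_eq_sum (n : ℕ) :
    AT n = ∑ L : Fin n → Fin n → Fin n with IsLatin L ∧ IsNormalized L ∧ IsUnipotent L,
      latinSign L := by
  have h : ∀ L : Fin n → Fin n → Fin n, latinSign L =
      (if latinSign L = 1 then 1 else 0) - if latinSign L = -1 then 1 else 0 := by
    intro L
    rcases latinSign_eq_one_or L with h | h <;> simp [h]
  rw [sum_congr rfl fun L _ => h L, sum_sub_distrib, sum_boole, sum_boole, AT]
  simp only [Nat.card_eq_fintype_card, Fintype.card_subtype, filter_filter, and_assoc]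

open Classical in
theorem coeff_monomial_prod_X {n : ℕ} (p : Fin n → Perm (Fin n)) :
    MvPolynomial.coeff (allOnes n)
      (∏ s, ∏ i, (MvPolynomial.X (i, p s i) : MvPolynomial (Fin n × Fin n) ℤ)) =
      if ∀ i, Function.Bijective fun s => p s i then 1 else 0 := by
  simp only [MvPolynomial.X, ← MvPolynomial.monomial_sum_one, MvPolynomial.coeff_monomial]
  refine if_congr ?_ rfl rfl
  have h (i j : Fin n) : (∑ s, ∑ i, Finsupp.single (i, p s i) 1 : Fin n × Fin n →₀ ℕ) (i, j) =
      #{s | p s i = j} := by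
    simp only [Finsupp.finsetSum_apply, Finsupp.single_apply, card_filter, Prod.mk.injEq]
    refine sum_congr rfl fun s _ => ?_
    rw [sum_eq_single i (by simp +contextual) (by simp)]
    simp
  simp only [Finsupp.ext_iff, Prod.forall, h, Function.bijective_iff_existsUnique, allOnes,
    Finsupp.equivFunOnFinite_symm_apply_apply, Fintype.existsUnique_iff_card_one]

open Classical in
/-- The coefficient of `∏ X i j` in a product of weighted sums over permutations is a sum over
Latin squares: the permutation chosen in factor `s` is the one of the symbol `s`. -/
theorem coeff_prod_sum {n : ℕ} (c : Fin n → Perm (Fin n) → ℤ) :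
    MvPolynomial.coeff (allOnes n)
      (∏ s, ∑ σ, (MvPolynomial.C (c s σ) * ∏ i, MvPolynomial.X (i, σ i))) =
      ∑ L : Fin n → Fin n → Fin n with IsLatin L, ∏ s, c s (symPerm L s) := by
  simp only [prod_univ_sum, prod_mul_distrib, ← map_prod, MvPolynomial.coeff_sum,
    MvPolynomial.coeff_C_mul, coeff_monomial_prod_X, mul_ite, mul_one, mul_zero,
    Fintype.piFinset_univ]
  rw [← sum_filter]
  symm
  have hmem (p : Fin n → Perm (Fin n)) (hp : p ∈ ({p | ∀ i, Function.Bijective fun s => p s i} :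
      Finset (Fin n → Perm (Fin n)))) : (fun i j => (permOf fun s => p s i).symm j) ∈
      ({L | IsLatin L} : Finset (Fin n → Fin n → Fin n)) := by
    simp only [mem_filter_univ] at hp ⊢
    refine ⟨fun i => Equiv.bijective _, fun j => Finite.injective_iff_bijective.mp ?_⟩
    intro i k hik
    set s := (permOf fun s => p s i).symm j with hs
    have hi : p s i = j := by rw [← permOf_apply (hp i), hs, Equiv.apply_symm_apply]
    have hk : p s k = j := by
      rw [← permOf_apply (hp k), show s = _ from hik, Equiv.apply_symm_apply]
    exact (p s).injective (hi.trans hk.symm)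
  refine sum_bij' (fun L _ => symPerm L)
    (fun p _ i j => (permOf fun s => p s i).symm j) ?_ hmem ?_ ?_ ?_
  · intro L hL
    simp only [mem_filter_univ] at hL ⊢
    intro i
    simp only [hL.symPerm_apply]
    exact Equiv.bijective _
  · intro L hL
    simp only [mem_filter_univ] at hL
    ext1 i
    ext1 j
    have hb : Function.Bijective fun s => symPerm L s i := by
      simp only [hL.symPerm_apply]
      exact Equiv.bijective _
    rw [Equiv.symm_apply_eq, permOf_apply hb, hL.symPerm_apply_self]
  · intro p hp
    have hL := hmem p hp
    simp only [mem_filter_univ] at hp hL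
    ext1 s
    ext1 i
    rw [hL.symPerm_apply_eq_iff, Equiv.symm_apply_eq, permOf_apply (hp i)]
  · simp

theorem IsLatin.comp {n : ℕ} {L : Fin n → Fin n → Fin n} (hL : IsLatin L)
    (σ τ : Perm (Fin n)) : IsLatin fun i j => τ (L i (σ j)) :=
  ⟨fun i => (τ.bijective.comp (hL.1 i)).comp σ.bijective, fun j => τ.bijective.comp (hL.2 (σ j))⟩

theorem IsLatin.latinSign_comp {n : ℕ} {L : Fin n → Fin n → Fin n} (hL : IsLatin L)
    (σ τ : Perm (Fin n)) :
    latinSign (fun i j => τ (L i (σ j))) = (Perm.sign σ : ℤ) ^ n * latinSign L := by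
  have hr : rowSign (fun i j => τ (L i (σ j))) =
      (Perm.sign τ : ℤ) ^ n * rowSign L * (Perm.sign σ : ℤ) ^ n := by
    simp only [rowSign, permOf_comp (hL.1 _) σ τ, Perm.sign_mul, Units.val_mul, prod_mul_distrib,
      prod_const, card_univ, Fintype.card_fin]
  have hc : colSign (fun i j => τ (L i (σ j))) = (Perm.sign τ : ℤ) ^ n * colSign L := by
    have h (j : Fin n) : (permOf fun i => τ (L i (σ j))) = τ * permOf fun i => L i (σ j) := by
      simpa using permOf_comp (hL.2 (σ j)) 1 τ
    simp only [colSign, h, Perm.sign_mul, Units.val_mul, prod_mul_distrib,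
      prod_const, card_univ, Fintype.card_fin]
    rw [Equiv.prod_comp σ fun j => (Perm.sign (permOf fun i => L i j) : ℤ)]
  have hτ : (Perm.sign τ : ℤ) ^ n * (Perm.sign τ : ℤ) ^ n = 1 := by
    rw [← mul_pow, ← Units.val_mul, Int.units_mul_self, Units.val_one, one_pow]
  rw [latinSign, latinSign, hr, hc]
  linear_combination (rowSign L * (Perm.sign σ : ℤ) ^ n * colSign L) * hτ

open Classical in
theorem sum_latinSign_mul_sign_symPerm {n : ℕ} (hn : Odd n) (s : Fin n) :
    ∑ L : Fin n → Fin n → Fin n with IsLatin L, latinSign L * Perm.sign (symPerm L s) =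
      n.factorial * ∑ L : Fin n → Fin n → Fin n with IsLatin L ∧ ∀ i, L i i = s, latinSign L := by
  have hcard : (n.factorial : ℤ) = #(univ : Finset (Perm (Fin n))) := by
    rw [card_univ, Fintype.card_perm, Fintype.card_fin]
  rw [hcard, ← nsmul_eq_mul, ← sum_const, ← sum_product']
  refine sum_bij' (fun L _ => (symPerm L s, fun i j => L i (symPerm L s j)))
    (fun x _ i j => x.2 i (x.1.symm j)) ?_ ?_ ?_ ?_ ?_
  · intro L hL
    simp only [mem_filter_univ, mem_product, mem_univ, true_and] at hL ⊢
    exact ⟨hL.comp (symPerm L s) 1, hL.apply_symPerm s⟩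
  · intro x hx
    simp only [mem_filter_univ, mem_product, mem_univ, true_and] at hx ⊢
    exact hx.1.comp x.1.symm 1
  · intro L hL
    simp
  · rintro ⟨α, K⟩ hx
    simp only [mem_filter_univ, mem_product, mem_univ, true_and] at hx
    have hα : symPerm (fun i j => K i (α.symm j)) s = α := by
      ext1 i
      refine (hx.1.comp α.symm 1).symPerm_apply_eq_iff.mpr ?_
      simp [hx.2]
    simp [hα]
  · intro L hL
    simp only [mem_filter_univ] at hL
    have h := hL.latinSign_comp (symPerm L s) 1
    simp only [Perm.one_apply] at h
    have hs : (Perm.sign (symPerm L s) : ℤ) ^ n = Perm.sign (symPerm L s) := by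
      obtain ⟨k, rfl⟩ := hn
      rw [pow_succ, pow_mul, ← Units.val_pow_eq_pow_val, Int.units_sq, Units.val_one, one_pow,
        one_mul]
    rw [h, hs, mul_comm]

open Classical in
theorem sum_latinSign_diag_zero (m : ℕ) :
    ∑ L : Fin (m + 1) → Fin (m + 1) → Fin (m + 1) with IsLatin L ∧ ∀ i, L i i = 0, latinSign L =
      m.factorial * AT (m + 1) := by
  have hcard : (m.factorial : ℤ) = #(univ : Finset (Perm (Fin m))) := by
    rw [card_univ, Fintype.card_perm, Fintype.card_fin]
  have hsymm (τ : Perm (Fin (m + 1))) (hτ : τ 0 = 0) :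
      Perm.decomposeFin.symm (0, (Perm.decomposeFin τ).2) = τ := by
    rw [Equiv.symm_apply_eq]
    refine Prod.ext ?_ rfl
    have h := Perm.decomposeFin_symm_apply_zero (Perm.decomposeFin τ).1 (Perm.decomposeFin τ).2
    rw [Prod.mk.eta, Equiv.symm_apply_apply, hτ] at h
    exact h
  have hrow {L : Fin (m + 1) → Fin (m + 1) → Fin (m + 1)} (hL : IsLatin L) (h0 : L 0 0 = 0) :
      permOf (L 0) 0 = 0 := (permOf_apply (hL.1 0) 0).trans h0
  rw [AT_eq_sum, hcard, ← nsmul_eq_mul, ← sum_const, ← sum_product']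
  refine sum_bij' (fun L _ => ((Perm.decomposeFin (permOf (L 0))).2,
      fun i j => (permOf (L 0)).symm (L i j)))
    (fun x _ i j => Perm.decomposeFin.symm (0, x.1) (x.2 i j)) ?_ ?_ ?_ ?_ ?_
  · intro L hL
    simp only [mem_filter_univ, mem_product, mem_univ, true_and] at hL ⊢
    refine ⟨hL.1.comp 1 (permOf (L 0)).symm, fun j => ?_, fun i k => ?_⟩
    · exact (Equiv.symm_apply_eq _).mpr (permOf_apply (hL.1.1 0) j).symm
    · simp only [hL.2]
  · intro x hx
    simp only [mem_filter_univ, mem_product, mem_univ, true_and] at hx ⊢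
    refine ⟨hx.1.comp 1 _, fun i => ?_⟩
    rw [hx.2.2 i 0, show x.2 0 0 = 0 from hx.2.1 0, Perm.decomposeFin_symm_apply_zero]
  · intro L hL
    simp only [mem_filter_univ] at hL
    simp [hsymm _ (hrow hL.1 (hL.2 0))]
  · rintro ⟨e, K⟩ hx
    simp only [mem_filter_univ, mem_product, mem_univ, true_and] at hx
    have hτ : permOf (fun j => Perm.decomposeFin.symm (0, e) (K 0 j)) =
        Perm.decomposeFin.symm (0, e) := by
      simp only [show ∀ j, K 0 j = j from hx.2.1, permOf_coe]
    simp [hτ]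
  · intro L hL
    simp only [mem_filter_univ] at hL
    simpa using (hL.1.latinSign_comp 1 (permOf (L 0)).symm).symm

end

/-- For odd `n`, the coefficient of `∏_{i,j} X i j` in `per(X) · det(X)^{n-1}`
equals `(-1)^{n(n-1)/2} n! (n-1)! AT(n)`. -/
theorem coeff_permanent_mul_det_pow_eq (n : ℕ) (hn : Odd n) :
    MvPolynomial.coeff (allOnes n) ((Xmat n).permanent * (Xmat n).det ^ (n - 1))
      = (-1) ^ (n * (n - 1) / 2) * n.factorial * (n - 1).factorial * AT n := by
  classical
  obtain ⟨m, rfl⟩ : ∃ m, n = m + 1 := Nat.exists_eq_succ_of_ne_zero hn.pos.ne'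
  have hper : (Xmat (m + 1)).permanent =
      ∑ σ : Equiv.Perm (Fin (m + 1)),
        MvPolynomial.C 1 * ∏ i, MvPolynomial.X (i, σ i) := by
    rw [← Matrix.permanent_transpose, Matrix.permanent]
    simp [Xmat]
  have hdet : (Xmat (m + 1)).det =
      ∑ σ : Equiv.Perm (Fin (m + 1)),
        MvPolynomial.C (Equiv.Perm.sign σ : ℤ) * ∏ i, MvPolynomial.X (i, σ i) := by
    rw [← Matrix.det_transpose, Matrix.det_apply']
    simp [Xmat]
  have hfactor : (Xmat (m + 1)).permanent * (Xmat (m + 1)).det ^ m =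
      ∏ s : Fin (m + 1), ∑ σ : Equiv.Perm (Fin (m + 1)),
        MvPolynomial.C (if s = 0 then 1 else (Equiv.Perm.sign σ : ℤ)) *
          ∏ i, MvPolynomial.X (i, σ i) := by
    rw [Fin.prod_univ_succ, hper, hdet]
    simp only [Fin.succ_ne_zero, if_true, if_false, Finset.prod_const, Finset.card_univ,
      Fintype.card_fin]
  have hsign (L : Fin (m + 1) → Fin (m + 1) → Fin (m + 1)) (hL : IsLatin L) :
      (∏ s, if s = 0 then 1 else (Equiv.Perm.sign (symPerm L s) : ℤ)) =
        (-1) ^ ((m + 1) * (m + 1 - 1) / 2) *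
          (latinSign L * (Equiv.Perm.sign (symPerm L 0) : ℤ)) := by
    have h := hL.symbolSign_eq
    rw [symbolSign, Fin.prod_univ_succ] at h
    rw [Fin.prod_univ_succ, ← mul_assoc, ← h, mul_right_comm, ← Units.val_mul, Int.units_mul_self]
    simp [Fin.succ_ne_zero]
  rw [Nat.add_sub_cancel, hfactor, coeff_prod_sum,
    Finset.sum_congr rfl fun L hL => hsign L (Finset.mem_filter.mp hL).2, ← Finset.mul_sum,
    sum_latinSign_mul_sign_symPerm hn, sum_latinSign_diag_zero, Nat.add_sub_cancel]
  ring
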